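/- Let p(0) = 0 and p(n) = 2^{-n} for n ≥ 1. For every i ≥ 1 the infinite matrix M_i with entries (M_i)_{k,l} = p(i+k+l) · 2^{-(i+k+l)} · √(C(i+k+l, i+k) · C(i+k+l, k)) for k, l ∈ ℕ is positive definite: for every nonzero finitely supported x : ℕ → ℝ, Σ_{k,l} x(k)·(M_i)_{k,l}·x(l) > 0. -/

import Mathlib

/-- Photon-number distribution of a shifted thermal state with mean photon number `n̄ = 1`:
`p(0) = 0` and `p(n) = 2^{-n}` for `n ≥ 1`. -/
noncomputable def pShifted : ℕ → ℝ := fun n =>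
  if n = 0 then 0 else (2 : ℝ) ^ (-(n : ℤ))

open Finset in
/-- Vandermonde's identity, rewritten as an `L D Lᵀ` factorisation of the Hankel matrix
`(i + k + l)!`. -/
theorem factorial_add_eq_sum (i k l N : ℕ) (hl : l < N) :
    ((i + k + l).factorial : ℝ) = ∑ j ∈ range N,
      (j.factorial / (i + j).factorial : ℝ) *
        ((i + k).factorial * k.choose j) * ((i + l).factorial * l.choose j) := by
  have hsub : range (l + 1) ⊆ range N := range_subset_range.2 hl
  rw [← sum_subset hsub]
  · have h1 : ((i + k + l).choose l : ℝ) =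
        ∑ j ∈ range (l + 1), (k.choose j : ℝ) * ((l + i).choose (l - j) : ℝ) := by
      have h := Nat.add_choose_eq k (l + i) l
      rw [Nat.sum_antidiagonal_eq_sum_range_succ_mk] at h
      rw [show i + k + l = k + (l + i) by ring, h]
      push_cast
      rfl
    have h2 : ((i + k + l).factorial : ℝ) =
        (i + k + l).choose l * l.factorial * (i + k).factorial := by
      have h := Nat.choose_mul_factorial_mul_factorial (Nat.le_add_left l (i + k))
      rw [Nat.add_sub_cancel] at h
      exact_mod_cast h.symm
    rw [h2, h1, sum_mul, sum_mul]
    refine sum_congr rfl fun j hj => ?_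
    have hjl : j ≤ l := Nat.lt_succ_iff.1 (mem_range.1 hj)
    rw [Nat.cast_choose ℝ hjl, Nat.cast_choose ℝ (show l - j ≤ l + i by omega),
      show l + i - (l - j) = i + j by omega, add_comm l i]
    have p1 : (j.factorial : ℝ) ≠ 0 := by positivity
    have p2 : ((l - j).factorial : ℝ) ≠ 0 := by positivity
    have p3 : ((i + j).factorial : ℝ) ≠ 0 := by positivity
    field_simp
  · intro j _ hj
    rw [Nat.choose_eq_zero_of_lt (show l < j by simpa using hj)]
    simp

/-- The product of the two binomial coefficients has an explicit square root. -/
theorem sqrt_choose_mul_choose (i k l : ℕ) :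
    √(((i + k + l).choose (i + k) : ℝ) * ((i + k + l).choose k : ℝ)) =
      (i + k + l).factorial /
        (√((i + k).factorial * k.factorial) * √((i + l).factorial * l.factorial)) := by
  rw [Nat.cast_choose ℝ (show i + k ≤ i + k + l by omega),
    Nat.cast_choose ℝ (show k ≤ i + k + l by omega),
    show i + k + l - (i + k) = l by omega, show i + k + l - k = i + l by omega,
    ← Real.sqrt_mul (by positivity), ← Real.sqrt_sq (Nat.cast_nonneg (i + k + l).factorial),
    ← Real.sqrt_div (by positivity), Real.sqrt_sq (Nat.cast_nonneg (i + k + l).factorial)]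
  congr 1
  field_simp

/-- The coefficients of the triangular factor of `M_i`. -/
noncomputable def blockFactor (i k j : ℕ) : ℝ :=
  (4 : ℝ)⁻¹ ^ k * (i + k).factorial / √((i + k).factorial * k.factorial) * k.choose j

theorem blockFactor_self_pos (i k : ℕ) : 0 < blockFactor i k k := by
  unfold blockFactor
  rw [Nat.choose_self]
  positivity

theorem blockFactor_eq_zero {i k j : ℕ} (h : k < j) : blockFactor i k j = 0 := by
  simp [blockFactor, Nat.choose_eq_zero_of_lt h]

open Finset in
theorem block_entry_eq_sum (i : ℕ) (hi : 1 ≤ i) (k l N : ℕ) (hl : l < N) :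
    pShifted (i + k + l) * (2 : ℝ) ^ (-((i + k + l : ℕ) : ℤ)) *
        √(((i + k + l).choose (i + k) : ℝ) * ((i + k + l).choose k : ℝ)) =
      ∑ j ∈ range N, (4 : ℝ)⁻¹ ^ i * (j.factorial / (i + j).factorial) *
        blockFactor i k j * blockFactor i l j := by
  have hp : pShifted (i + k + l) * (2 : ℝ) ^ (-((i + k + l : ℕ) : ℤ)) =
      (4 : ℝ)⁻¹ ^ (i + k + l) := by
    rw [pShifted, if_neg (by omega), zpow_neg, zpow_natCast, ← inv_pow, ← mul_pow]
    norm_num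
  rw [hp, sqrt_choose_mul_choose, factorial_add_eq_sum i k l N hl, sum_div, mul_sum]
  refine sum_congr rfl fun j _ => ?_
  unfold blockFactor
  rw [pow_add, pow_add]
  ring

/-- Appendix C: for the shifted thermal state with `n̄ = 1`, all off-diagonal blocks `M_i`
(`i ≥ 1`) of the partially transposed beam-splitter output, with entries
`(M_i)_{k,l} = p(i+k+l) · 2^{-(i+k+l)} · √(C(i+k+l, i+k)·C(i+k+l, k))`,
are positive definite in the finitely-supported sense. -/
theorem offDiagonal_blocks_posDef (i : ℕ) (hi : 1 ≤ i) :
    ∀ x : ℕ →₀ ℝ, x ≠ 0 →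
      0 < ∑ k ∈ x.support, ∑ l ∈ x.support,
        x k *
          (pShifted (i + k + l) * (2 : ℝ) ^ (-((i + k + l : ℕ) : ℤ)) *
            Real.sqrt ((Nat.choose (i + k + l) (i + k) : ℝ) *
              (Nat.choose (i + k + l) k : ℝ))) *
        x l := by
  intro x hx
  let N := x.support.max' (Finsupp.support_nonempty_iff.2 hx)
  have hmem : N ∈ x.support := Finset.max'_mem _ _
  have hle : ∀ k ∈ x.support, k ≤ N := fun k hk => Finset.le_max' _ k hk
  have key : ∑ k ∈ x.support, ∑ l ∈ x.support,
        x k *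
          (pShifted (i + k + l) * (2 : ℝ) ^ (-((i + k + l : ℕ) : ℤ)) *
            Real.sqrt ((Nat.choose (i + k + l) (i + k) : ℝ) *
              (Nat.choose (i + k + l) k : ℝ))) *
        x l =
      ∑ j ∈ Finset.range (N + 1), (4 : ℝ)⁻¹ ^ i * (j.factorial / (i + j).factorial) *
        (∑ k ∈ x.support, x k * blockFactor i k j) ^ 2 := by
    simp_rw [sq, Finset.sum_mul_sum, Finset.mul_sum]
    refine Eq.trans ?_ Finset.sum_comm
    refine Finset.sum_congr rfl fun k _ => ?_
    refine Eq.trans ?_ Finset.sum_comm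
    refine Finset.sum_congr rfl fun l hl => ?_
    rw [block_entry_eq_sum i hi k l (N + 1) (Nat.lt_succ_of_le (hle l hl)),
      Finset.mul_sum, Finset.sum_mul]
    refine Finset.sum_congr rfl fun j _ => ?_
    ring
  rw [key]
  refine Finset.sum_pos' (fun j _ => by positivity) ⟨N, Finset.self_mem_range_succ N, ?_⟩
  have htop : ∑ k ∈ x.support, x k * blockFactor i k N = x N * blockFactor i N N := by
    refine Finset.sum_eq_single_of_mem N hmem fun k hk hkN => ?_
    rw [blockFactor_eq_zero (lt_of_le_of_ne (hle k hk) hkN), mul_zero]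
  have hne : x N * blockFactor i N N ≠ 0 :=
    mul_ne_zero (Finsupp.mem_support_iff.1 hmem) (blockFactor_self_pos i N).ne'
  rw [htop]
  positivity
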